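/- Let ΨX, ΨY ∈ ℂ^{M×N} and suppose (1/√M) ΨX = QΣZ* where Q ∈ ℂ^{M×r} and Z ∈ ℂ^{N×r} satisfy Q*Q = I_r and Z*Z = I_r, and Σ ∈ ℂ^{r×r} is diagonal with strictly positive real diagonal entries. Define the kernel EDMD matrix K̂ = (1/M) (Σ^{-1}Q*) ΨY ΨX* (QΣ^{-1}) ∈ ℂ^{r×r}, and set Ψ̂X = Z ∈ ℂ^{N×r} and Ψ̂Y = (1/√M) ΨY* Q Σ^{-1} ∈ ℂ^{N×r}. Then Z* Ψ̂Y = K̂*, and B₀ = K̂* minimizes ‖Ψ̂Y − Ψ̂X B‖_F over all B ∈ ℂ^{r×r}. -/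

import Mathlib

open Matrix

/-- The Frobenius norm of a complex matrix. -/
noncomputable def frobNorm {m n : Type*} [Fintype m] [Fintype n]
    (A : Matrix m n ℂ) : ℝ :=
  Real.sqrt (∑ i, ∑ j, ‖A i j‖ ^ 2)

theorem frob_sq_aux {m n : Type*} [Fintype m] [Fintype n] (A : Matrix m n ℂ) :
    ((∑ i, ∑ j, ‖A i j‖ ^ 2 : ℝ) : ℂ) = Matrix.trace (Aᴴ * A) := by
  rw [Finset.sum_comm]
  simp only [Matrix.trace, Matrix.diag_apply, Matrix.mul_apply, Matrix.conjTranspose_apply]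
  push_cast
  refine Finset.sum_congr rfl fun j _ => Finset.sum_congr rfl fun i _ => ?_
  exact (Complex.conj_mul' (A i j)).symm

/-- Let `ΨX, ΨY ∈ ℂ^{M×N}` with reduced SVD
`(1/√M) ΨX = Q Σ Z*` (`Q*Q = I`, `Z*Z = I`, `Σ` diagonal with strictly
positive real diagonal).  Define the kernel EDMD matrix
`K̂ = (1/M) (Σ⁻¹ Q*) ΨY ΨX* (Q Σ⁻¹)` and set `Ψ̂X = Z`,
`Ψ̂Y = (1/√M) ΨY* Q Σ⁻¹`.  Then `Z* Ψ̂Y = K̂*`, and `B₀ = K̂*` minimizes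
`‖Ψ̂Y − Ψ̂X B‖_F` over all `B ∈ ℂ^{r×r}`. -/
theorem stmt11 {M N r : ℕ} (hM : 0 < M)
    (ΨX ΨY : Matrix (Fin M) (Fin N) ℂ)
    (Q : Matrix (Fin M) (Fin r) ℂ) (Z : Matrix (Fin N) (Fin r) ℂ)
    (S : Matrix (Fin r) (Fin r) ℂ)
    (hQ : Qᴴ * Q = 1) (hZ : Zᴴ * Z = 1)
    (d : Fin r → ℝ) (hd : ∀ i, 0 < d i)
    (hS : S = Matrix.diagonal fun i => (d i : ℂ))
    (hSVD : (((Real.sqrt M)⁻¹ : ℝ) : ℂ) • ΨX = Q * S * Zᴴ)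
    (Khat : Matrix (Fin r) (Fin r) ℂ)
    (hKhat : Khat = (M : ℂ)⁻¹ • ((S⁻¹ * Qᴴ) * (ΨY * ΨXᴴ) * (Q * S⁻¹)))
    (ΨhX : Matrix (Fin N) (Fin r) ℂ) (hΨhX : ΨhX = Z)
    (ΨhY : Matrix (Fin N) (Fin r) ℂ)
    (hΨhY : ΨhY = (((Real.sqrt M)⁻¹ : ℝ) : ℂ) • (ΨYᴴ * (Q * S⁻¹))) :
    Zᴴ * ΨhY = Khatᴴ ∧
      ∀ B : Matrix (Fin r) (Fin r) ℂ,
        frobNorm (ΨhY - ΨhX * Khatᴴ) ≤ frobNorm (ΨhY - ΨhX * B) := by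
  have hdet : IsUnit S.det := by
    rw [hS, Matrix.det_diagonal, isUnit_iff_ne_zero]
    exact Finset.prod_ne_zero_iff.mpr fun i _ => by exact_mod_cast (hd i).ne'
  have hSH : Sᴴ = S := by
    rw [hS, Matrix.diagonal_conjTranspose]
    congr 1
    funext i
    simp
  have hSi : (S⁻¹)ᴴ = S⁻¹ := by rw [Matrix.conjTranspose_nonsing_inv, hSH]
  set c : ℂ := (((Real.sqrt M)⁻¹ : ℝ) : ℂ) with hc
  have hcc : (M : ℂ)⁻¹ = c * c := by
    rw [hc, ← Complex.ofReal_mul, ← mul_inv, Real.mul_self_sqrt (Nat.cast_nonneg M)]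
    simp
  have h0 : S⁻¹ * Qᴴ * (c • ΨX) = Zᴴ := by
    rw [hSVD]
    calc S⁻¹ * Qᴴ * (Q * S * Zᴴ) = S⁻¹ * (Qᴴ * Q) * S * Zᴴ := by simp only [Matrix.mul_assoc]
      _ = Zᴴ := by rw [hQ, Matrix.mul_one, Matrix.nonsing_inv_mul _ hdet, Matrix.one_mul]
  have h1 : Zᴴ * ΨhY = Khatᴴ := by
    have hM' : star ((M : ℂ)⁻¹) = c * c := by rw [← hcc]; simp
    rw [hKhat, hΨhY, Matrix.conjTranspose_smul, hM', ← h0]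
    simp only [Matrix.conjTranspose_mul, Matrix.conjTranspose_conjTranspose, hSi,
      Matrix.mul_assoc, Matrix.mul_smul, Matrix.smul_mul, smul_smul]
  refine ⟨h1, fun B => ?_⟩
  subst hΨhX
  apply Real.sqrt_le_sqrt
  have hE : ΨhXᴴ * (ΨhY - ΨhX * Khatᴴ) = 0 := by
    rw [Matrix.mul_sub, h1, ← Matrix.mul_assoc, hZ, Matrix.one_mul, sub_self]
  have hE2 : (ΨhY - ΨhX * Khatᴴ)ᴴ * ΨhX = 0 := by
    have := congrArg Matrix.conjTranspose hE
    simpa only [Matrix.conjTranspose_mul, Matrix.conjTranspose_conjTranspose,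
      Matrix.conjTranspose_zero] using this
  have hB : ΨhY - ΨhX * B = (ΨhY - ΨhX * Khatᴴ) + ΨhX * (Khatᴴ - B) := by
    rw [Matrix.mul_sub]; abel
  rw [hB]
  generalize ΨhY - ΨhX * Khatᴴ = E at *
  generalize Khatᴴ - B = C at *
  have key : (E + ΨhX * C)ᴴ * (E + ΨhX * C) = Eᴴ * E + Cᴴ * C := by
    rw [Matrix.conjTranspose_add, Matrix.add_mul, Matrix.mul_add, Matrix.mul_add,
      ← Matrix.mul_assoc Eᴴ, hE2, Matrix.conjTranspose_mul, Matrix.mul_assoc Cᴴ _ E, hE,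
      Matrix.mul_assoc Cᴴ, ← Matrix.mul_assoc ΨhXᴴ, hZ]
    simp
  have h2 : (∑ i, ∑ j, ‖(E + ΨhX * C) i j‖ ^ 2 : ℝ)
      = (∑ i, ∑ j, ‖E i j‖ ^ 2) + ∑ i, ∑ j, ‖C i j‖ ^ 2 := by
    apply Complex.ofReal_injective
    rw [Complex.ofReal_add, frob_sq_aux, frob_sq_aux, frob_sq_aux, key, Matrix.trace_add]
  rw [h2]
  exact le_add_of_nonneg_right (by positivity)
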